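/- arXiv:2402.06024 — 2 statements merged into one kernel-verified Lean document; each statement's English description precedes it below -/
import Mathlib

section
/- Let F be an SWF on a domain D ∈ 𝒟^PT satisfying unanimity and IIA, let G be a coalition with ∅ ≠ G ≠ N, and suppose there exist distinct alternatives α,β ∈ X and a profile P₀ ∈ D such that (α P₀ᵢ β iff i ∈ G) for every voter i and α F(P₀) β. Then G is almost-decisive w.r.t. F. -/
open Set
namespace ArrowSC

/-- A profile assigns to each voter a binary relation (their preference) on alternatives. -/
abbrev Profile (n : ℕ) (X : Type*) := Fin n → X → X → Prop

/-- `r` is a strict total order. -/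
def IsSTO {X : Type*} (r : X → X → Prop) : Prop :=
  (∀ x, ¬ r x x) ∧ (∀ x y z, r x y → r y z → r x z) ∧
  (∀ x y, x ≠ y → r x y ∨ r y x)

/-- A genuine profile: every voter's relation is a strict total order, i.e. a member of W(X)^n. -/
def IsProfile {n : ℕ} {X : Type*} (P : Profile n X) : Prop := ∀ i, IsSTO (P i)

/-- A domain: a nonempty set of profiles, each a member of W(X)^n. -/
def IsDomain {n : ℕ} {X : Type*} (D : Set (Profile n X)) : Prop :=
  D.Nonempty ∧ ∀ P ∈ D, IsProfile P

/-- `F` is a social welfare function on `D`: it sends each profile in `D` to a strict total order. -/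
def IsSWF {n : ℕ} {X : Type*} (D : Set (Profile n X))
    (F : Profile n X → X → X → Prop) : Prop :=
  ∀ P ∈ D, IsSTO (F P)

def Unanimity {n : ℕ} {X : Type*} (D : Set (Profile n X))
    (F : Profile n X → X → X → Prop) : Prop :=
  ∀ P ∈ D, ∀ a b : X, (∀ i, P i a b) → F P a b

def IIA {n : ℕ} {X : Type*} (D : Set (Profile n X))
    (F : Profile n X → X → X → Prop) : Prop :=
  ∀ P ∈ D, ∀ P' ∈ D, ∀ a b : X, (∀ i, P i a b ↔ P' i a b) → (F P a b ↔ F P' a b)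

def IsDictator {n : ℕ} {X : Type*} (D : Set (Profile n X))
    (F : Profile n X → X → X → Prop) (d : Fin n) : Prop :=
  ∀ P ∈ D, ∀ a b : X, P d a b → F P a b

def Dictatorial {n : ℕ} {X : Type*} (D : Set (Profile n X))
    (F : Profile n X → X → X → Prop) : Prop :=
  ∃ d, IsDictator D F d

/-- Coalition `G` is almost-decisive over the ordered pair `(a, b)` w.r.t. `F`. -/
def AlmostDecisivePair {n : ℕ} {X : Type*} (D : Set (Profile n X))
    (F : Profile n X → X → X → Prop) (G : Set (Fin n)) (a b : X) : Prop :=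
  ∀ P ∈ D, (∀ i, P i a b ↔ i ∈ G) → F P a b

/-- Coalition `G` is almost-decisive over `Y` w.r.t. `F`. -/
def AlmostDecisiveOn {n : ℕ} {X : Type*} (D : Set (Profile n X))
    (F : Profile n X → X → X → Prop) (G : Set (Fin n)) (Y : Set X) : Prop :=
  ∀ a ∈ Y, ∀ b ∈ Y, a ≠ b → AlmostDecisivePair D F G a b

/-- Coalition `G` is almost-decisive (over all of X) w.r.t. `F`. -/
def AlmostDecisive {n : ℕ} {X : Type*} (D : Set (Profile n X))
    (F : Profile n X → X → X → Prop) (G : Set (Fin n)) : Prop :=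
  ∀ a b : X, a ≠ b → AlmostDecisivePair D F G a b

/-- The restriction of `r` to the triple `{a,b,c}` is the order `a` above `b` above `c`. -/
def RanksTriple {X : Type*} (r : X → X → Prop) (a b c : X) : Prop :=
  r a b ∧ r b c ∧ r a c

/-- The polarized profile `(G : abc, Gᶜ : a'b'c')` on a triple is a subprofile of `D`,
i.e. it belongs to the restriction `D|_{triple}`. -/
def HasPolarizedSubprofile {n : ℕ} {X : Type*} (D : Set (Profile n X)) (G : Set (Fin n))
    (a b c a' b' c' : X) : Prop :=
  ∃ P ∈ D, ∀ i, (i ∈ G → RanksTriple (P i) a b c) ∧ (i ∉ G → RanksTriple (P i) a' b' c')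

/-- `D_1(G, {a,b,c}) ⊆ D|_{{a,b,c}}`. -/
def D1sub {n : ℕ} {X : Type*} (D : Set (Profile n X)) (G : Set (Fin n)) (a b c : X) : Prop :=
  HasPolarizedSubprofile D G b c a a b c ∧
  HasPolarizedSubprofile D G b a c a c b ∧
  HasPolarizedSubprofile D G a b c c a b ∧
  HasPolarizedSubprofile D G a c b c b a ∧
  HasPolarizedSubprofile D G c a b b c a ∧
  HasPolarizedSubprofile D G c b a b a c

/-- `D_2(G, {a,b,c}) ⊆ D|_{{a,b,c}}`. -/
def D2sub {n : ℕ} {X : Type*} (D : Set (Profile n X)) (G : Set (Fin n)) (a b c : X) : Prop :=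
  HasPolarizedSubprofile D G a b c b c a ∧
  HasPolarizedSubprofile D G a c b b a c ∧
  HasPolarizedSubprofile D G c a b a b c ∧
  HasPolarizedSubprofile D G c b a a c b ∧
  HasPolarizedSubprofile D G b c a c a b ∧
  HasPolarizedSubprofile D G b a c c b a

/-- The class 𝒟^PT of polarization over triples. -/
def ClassPT {n : ℕ} {X : Type*} (D : Set (Profile n X)) : Prop :=
  ∀ G : Set (Fin n), G ≠ ∅ → G ≠ univ →
    ∀ a b c : X, a ≠ b → b ≠ c → a ≠ c →
      D1sub D G a b c ∨ D2sub D G a b c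

/-- The class 𝒟^DT of diversity over triples. -/
def ClassDT {n : ℕ} {X : Type*} (D : Set (Profile n X)) : Prop :=
  ∀ G G' : Set (Fin n), ¬ G ⊆ G' → ¬ G' ⊆ G →
    ∃ a b c : X, a ≠ b ∧ b ≠ c ∧ a ≠ c ∧ ∃ P ∈ D, ∀ i,
      (P i a b ↔ i ∈ G) ∧ (P i b c ↔ i ∈ G') ∧ (P i c a ↔ i ∉ G ∩ G')

/-- `D` is Arrow-inconsistent. -/
def ArrowInconsistent {n : ℕ} {X : Type*} (D : Set (Profile n X)) : Prop :=
  ∀ F : Profile n X → X → X → Prop,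
    IsSWF D F → Unanimity D F → IIA D F → Dictatorial D F

/-- `a` is the most-preferred among `{a,b,c}` according to `r`. -/
def TripleBest {X : Type*} (r : X → X → Prop) (a b c : X) : Prop := r a b ∧ r a c

/-- `a` is the least-preferred among `{a,b,c}` according to `r`. -/
def TripleWorst {X : Type*} (r : X → X → Prop) (a b c : X) : Prop := r b a ∧ r c a

/-- `a` is the middle-preferred among `{a,b,c}` according to `r`. -/
def TripleMiddle {X : Type*} (r : X → X → Prop) (a b c : X) : Prop :=
  (r b a ∧ r a c) ∨ (r c a ∧ r a b)

/-- In profile `P`, alternative `a` is never placed as the most-preferred, or never as the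
middle-preferred, or never as the least-preferred alternative among `{a,b,c}`. -/
def NeverBMW {n : ℕ} {X : Type*} (P : Profile n X) (a b c : X) : Prop :=
  (∀ i, ¬ TripleBest (P i) a b c) ∨ (∀ i, ¬ TripleMiddle (P i) a b c) ∨
  (∀ i, ¬ TripleWorst (P i) a b c)

/-- Sen's value-restriction of a profile over `Y`. -/
def ValueRestricted {n : ℕ} {X : Type*} (P : Profile n X) (Y : Set X) : Prop :=
  ∀ a ∈ Y, ∀ b ∈ Y, ∀ c ∈ Y, a ≠ b → b ≠ c → a ≠ c →
    NeverBMW P a b c ∨ NeverBMW P b a c ∨ NeverBMW P c a b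

/-- The strict total order on the triple `{a,b,c}` ranking `a` above `b` above `c`,
viewed as a relation with support in `{a,b,c}`. -/
def seqOrder {X : Type*} (a b c : X) : X → X → Prop :=
  fun x y => (x = a ∧ y = b) ∨ (x = b ∧ y = c) ∨ (x = a ∧ y = c)

/-- `r` is a strict total order on the triple `{a,b,c}` (with support in the triple). -/
def IsTripleOrder {X : Type*} (a b c : X) (r : X → X → Prop) : Prop :=
  (∀ x y, r x y → x ∈ ({a, b, c} : Set X) ∧ y ∈ ({a, b, c} : Set X)) ∧
  (∀ x, ¬ r x x) ∧ (∀ x y z, r x y → r y z → r x z) ∧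
  (∀ x ∈ ({a, b, c} : Set X), ∀ y ∈ ({a, b, c} : Set X), x ≠ y → r x y ∨ r y x)

/-- The polarized profile `(G : Q, Gᶜ : Q')`. -/
def polarizedProfile {n : ℕ} {X : Type*} (G : Set (Fin n)) (Q Q' : X → X → Prop) :
    Profile n X :=
  fun i x y => (i ∈ G ∧ Q x y) ∨ (i ∉ G ∧ Q' x y)

/-- `Q` and `Q'` differ on how they rank the pair `{x, y}`. -/
def DifferOn {X : Type*} (Q Q' : X → X → Prop) (x y : X) : Prop := ¬ (Q x y ↔ Q' x y)

/-- `Q` and `Q'` differ on exactly two of the three unordered pairs of the triple `{a,b,c}`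
and coincide on the remaining pair. -/
def StronglyPolarizedPair {X : Type*} (a b c : X) (Q Q' : X → X → Prop) : Prop :=
  (DifferOn Q Q' a b ∧ DifferOn Q Q' b c ∧ ¬ DifferOn Q Q' a c) ∨
  (DifferOn Q Q' a b ∧ ¬ DifferOn Q Q' b c ∧ DifferOn Q Q' a c) ∨
  (¬ DifferOn Q Q' a b ∧ DifferOn Q Q' b c ∧ DifferOn Q Q' a c)

/-- The set `D_1(G, {a,b,c})` of polarized profiles on the triple `{a,b,c}`. -/
def D1set {n : ℕ} {X : Type*} (G : Set (Fin n)) (a b c : X) : Set (Profile n X) :=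
  { polarizedProfile G (seqOrder b c a) (seqOrder a b c),
    polarizedProfile G (seqOrder b a c) (seqOrder a c b),
    polarizedProfile G (seqOrder a b c) (seqOrder c a b),
    polarizedProfile G (seqOrder a c b) (seqOrder c b a),
    polarizedProfile G (seqOrder c a b) (seqOrder b c a),
    polarizedProfile G (seqOrder c b a) (seqOrder b a c) }

/-- The set `D_2(G, {a,b,c})` of polarized profiles on the triple `{a,b,c}`. -/
def D2set {n : ℕ} {X : Type*} (G : Set (Fin n)) (a b c : X) : Set (Profile n X) :=
  { polarizedProfile G (seqOrder a b c) (seqOrder b c a),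
    polarizedProfile G (seqOrder a c b) (seqOrder b a c),
    polarizedProfile G (seqOrder c a b) (seqOrder a b c),
    polarizedProfile G (seqOrder c b a) (seqOrder a c b),
    polarizedProfile G (seqOrder b c a) (seqOrder c a b),
    polarizedProfile G (seqOrder b a c) (seqOrder c b a) }

/-- The set of all strongly polarized profiles on the triple `{a,b,c}`
of the form `(G : Q, Gᶜ : Q')`. -/
def SPset {n : ℕ} {X : Type*} (G : Set (Fin n)) (a b c : X) : Set (Profile n X) :=
  { p | ∃ Q Q', IsTripleOrder a b c Q ∧ IsTripleOrder a b c Q' ∧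
      StronglyPolarizedPair a b c Q Q' ∧ p = polarizedProfile G Q Q' }
section Contagion

variable {X : Type*} {n : ℕ} {D : Set (Profile n X)} {F : Profile n X → X → X → Prop}
  {G : Set (Fin n)}

theorem IsSTO.asymm {r : X → X → Prop} (hr : IsSTO r) {x y : X} (hxy : r x y) : ¬ r y x :=
  fun hyx => hr.1 x (hr.2.1 x y x hxy hyx)

/-- Under IIA, a single profile in which `G` prevails on a pair makes `G` almost-decisive there. -/
theorem IIA.almostDecisivePair (hIIA : IIA D F) {P : Profile n X} (hP : P ∈ D) {x y : X}
    (hG : ∀ i, P i x y ↔ i ∈ G) (hxy : F P x y) : AlmostDecisivePair D F G x y :=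
  fun Q hQ hQG => (hIIA P hP Q hQ x y fun i => (hG i).trans (hQG i).symm).1 hxy

/-- If all voters rank `x` above `y`, almost-decisiveness passes from `(y, z)` to `(x, z)`. -/
theorem AlmostDecisivePair.raise_left (hD : IsDomain D) (hF : IsSWF D F) (hU : Unanimity D F)
    (hIIA : IIA D F) {x y z : X} (hP : HasPolarizedSubprofile D G x y z z x y)
    (h : AlmostDecisivePair D F G y z) : AlmostDecisivePair D F G x z := by
  obtain ⟨P, hPD, hP⟩ := hP
  have hxy : ∀ i, P i x y := fun i => by
    by_cases hi : i ∈ G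
    · exact ((hP i).1 hi).1
    · exact ((hP i).2 hi).2.1
  have hyz : ∀ i, P i y z ↔ i ∈ G := fun i =>
    ⟨fun hi => by_contra fun hn => (hD.2 P hPD i).asymm hi ((hP i).2 hn).2.2,
      fun hi => ((hP i).1 hi).2.1⟩
  have hxz : ∀ i, P i x z ↔ i ∈ G := fun i =>
    ⟨fun hi => by_contra fun hn => (hD.2 P hPD i).asymm hi ((hP i).2 hn).1,
      fun hi => ((hP i).1 hi).2.2⟩
  exact hIIA.almostDecisivePair hPD hxz
    ((hF P hPD).2.1 x y z (hU P hPD x y hxy) (h P hPD hyz))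

/-- If all voters rank `y` above `z`, almost-decisiveness passes from `(x, y)` to `(x, z)`. -/
theorem AlmostDecisivePair.lower_right (hD : IsDomain D) (hF : IsSWF D F) (hU : Unanimity D F)
    (hIIA : IIA D F) {x y z : X} (hP : HasPolarizedSubprofile D G x y z y z x)
    (h : AlmostDecisivePair D F G x y) : AlmostDecisivePair D F G x z := by
  obtain ⟨P, hPD, hP⟩ := hP
  have hyz : ∀ i, P i y z := fun i => by
    by_cases hi : i ∈ G
    · exact ((hP i).1 hi).2.1
    · exact ((hP i).2 hi).1
  have hxy : ∀ i, P i x y ↔ i ∈ G := fun i =>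
    ⟨fun hi => by_contra fun hn => (hD.2 P hPD i).asymm hi ((hP i).2 hn).2.2,
      fun hi => ((hP i).1 hi).1⟩
  have hxz : ∀ i, P i x z ↔ i ∈ G := fun i =>
    ⟨fun hi => by_contra fun hn => (hD.2 P hPD i).asymm hi ((hP i).2 hn).2.1,
      fun hi => ((hP i).1 hi).2.2⟩
  exact hIIA.almostDecisivePair hPD hxz
    ((hF P hPD).2.1 x y z (h P hPD hxy) (hU P hPD y z hyz))

/-- Almost-decisiveness over `(a, b)` spreads to the other five ordered pairs of a triple. -/
theorem AlmostDecisivePair.triple (hD : IsDomain D) (hPT : ClassPT D) (hF : IsSWF D F)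
    (hU : Unanimity D F) (hIIA : IIA D F) (hGne : G ≠ ∅) (hGuniv : G ≠ univ) {a b c : X}
    (hab : a ≠ b) (hbc : b ≠ c) (hac : a ≠ c) (h : AlmostDecisivePair D F G a b) :
    AlmostDecisivePair D F G a c ∧ AlmostDecisivePair D F G b a ∧
      AlmostDecisivePair D F G b c ∧ AlmostDecisivePair D F G c a ∧
      AlmostDecisivePair D F G c b := by
  rcases hPT G hGne hGuniv a b c hab hbc hac with
    ⟨hba, hbc', hac', -, hcb, hca⟩ | ⟨hac', -, hcb, hca, hba, hbc'⟩
  · have h₁ := raise_left hD hF hU hIIA hcb h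
    have h₂ := lower_right hD hF hU hIIA hca h₁
    have h₃ := raise_left hD hF hU hIIA hba h₂
    have h₄ := lower_right hD hF hU hIIA hbc' h₃
    exact ⟨raise_left hD hF hU hIIA hac' h₄, h₃, h₄, h₂, h₁⟩
  · have h₁ := lower_right hD hF hU hIIA hac' h
    have h₂ := raise_left hD hF hU hIIA hbc' h₁
    have h₃ := lower_right hD hF hU hIIA hba h₂
    have h₄ := raise_left hD hF hU hIIA hca h₃
    exact ⟨h₁, h₃, h₂, h₄, lower_right hD hF hU hIIA hcb h₄⟩

end Contagion

/-- the contagion lemma for domains in 𝒟^PT. -/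
theorem contagion {X : Type*} [Fintype X] {n : ℕ}
    (hX : 3 ≤ Fintype.card X) (hn : 2 ≤ n)
    (D : Set (Profile n X)) (hD : IsDomain D) (hPT : ClassPT D)
    (F : Profile n X → X → X → Prop) (hF : IsSWF D F)
    (hU : Unanimity D F) (hIIA : IIA D F)
    (G : Set (Fin n)) (hGne : G ≠ ∅) (hGuniv : G ≠ univ)
    (h : ∃ a b : X, a ≠ b ∧ ∃ P₀ ∈ D, (∀ i, P₀ i a b ↔ i ∈ G) ∧ F P₀ a b) :
    AlmostDecisive D F G := by
  obtain ⟨a, b, hab, P₀, hP₀, hG, hFab⟩ := h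
  have had : AlmostDecisivePair D F G a b := hIIA.almostDecisivePair hP₀ hG hFab
  have spread : ∀ {x y z : X}, x ≠ y → y ≠ z → x ≠ z → AlmostDecisivePair D F G x y → _ :=
    fun hxy hyz hxz => AlmostDecisivePair.triple hD hPT hF hU hIIA hGne hGuniv hxy hyz hxz
  obtain ⟨c, hca, hcb⟩ : ∃ c, c ≠ a ∧ c ≠ b := by
    classical
    obtain ⟨c, -, hc⟩ := Finset.exists_mem_notMem_of_card_lt_card
      (s := {a, b}) (t := Finset.univ) (Finset.card_le_two.trans_lt hX)
    exact ⟨c, by simpa using hc⟩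
  have hba : AlmostDecisivePair D F G b a := (spread hab hcb.symm hca.symm had).2.1
  have from_a : ∀ y, y ≠ a → AlmostDecisivePair D F G a y := fun y hya => by
    by_cases hyb : y = b
    · exact hyb ▸ had
    · exact (spread hab (Ne.symm hyb) hya.symm had).1
  have to_a : ∀ x, x ≠ a → AlmostDecisivePair D F G x a := fun x hxa => by
    by_cases hxb : x = b
    · exact hxb ▸ hba
    · exact (spread hab (Ne.symm hxb) hxa.symm had).2.2.2.1
  intro x y hxy
  by_cases hxa : x = a
  · subst hxa
    exact from_a y hxy.symm
  by_cases hya : y = a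
  · subst hya
    exact to_a x hxy
  exact (spread hxa (Ne.symm hya) hxy (to_a x hxa)).1

end ArrowSC
end

section
/- If D is a domain belonging to 𝒟^PT ∩ 𝒟^DT, then D is super-Arrovian: D is Arrow-inconsistent, and every domain D' with D ⊆ D' ⊆ W(X)^n is Arrow-inconsistent. -/
open Set
namespace ArrowSC

theorem exists_ne_ne_of_three_le_card {X : Type*} [Fintype X] (hX : 3 ≤ Fintype.card X)
    (a b : X) : ∃ c, c ≠ a ∧ c ≠ b := by
  classical
  have hlt : ({a, b} : Finset X).card < (Finset.univ : Finset X).card :=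
    Finset.card_le_two.trans_lt (by rwa [Finset.card_univ])
  obtain ⟨c, -, hc⟩ := Finset.exists_mem_notMem_of_card_lt_card hlt
  exact ⟨c, by simpa using hc⟩

/-- Under IIA, one profile in which exactly the members of `G` rank `a` above `b` and society
follows them makes `G` almost decisive over `(a, b)`. -/
theorem almostDecisivePair_of_witness {X : Type*} {n : ℕ} {D : Set (Profile n X)}
    {F : Profile n X → X → X → Prop} (hI : IIA D F) {G : Set (Fin n)} {a b : X}
    {P : Profile n X} (hP : P ∈ D) (hG : ∀ i, P i a b ↔ i ∈ G) (hF : F P a b) :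
    AlmostDecisivePair D F G a b :=
  fun Q hQ hQG => (hI P hP Q hQ a b fun i => (hG i).trans (hQG i).symm).1 hF

theorem IsSTO.asymm_s16 {X : Type*} {r : X → X → Prop} (h : IsSTO r) {a b : X} (hab : r a b) :
    ¬ r b a := fun hba => h.1 a (h.2.1 a b a hab hba)

theorem IsSTO.not_iff {X : Type*} {r : X → X → Prop} (h : IsSTO r) {a b : X} (hab : a ≠ b) :
    ¬ r a b ↔ r b a :=
  ⟨(h.2.2 a b hab).resolve_left, fun hba => h.asymm_s16 hba⟩

theorem AlmostDecisivePair.of_improve_left {X : Type*} {n : ℕ} {D : Set (Profile n X)}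
    {F : Profile n X → X → X → Prop} (hD : IsDomain D) (hF : IsSWF D F) (hU : Unanimity D F)
    (hI : IIA D F) {G : Set (Fin n)} {x y z : X} (hS : HasPolarizedSubprofile D G x y z z x y)
    (h : AlmostDecisivePair D F G y z) : AlmostDecisivePair D F G x z := by
  obtain ⟨P, hP, hPG⟩ := hS
  have hxy : F P x y := hU P hP x y fun i => by
    by_cases hi : i ∈ G
    · exact ((hPG i).1 hi).1
    · exact ((hPG i).2 hi).2.1
  have hyz : F P y z := h P hP fun i =>
    ⟨fun hi => by_contra fun hn => (hD.2 P hP i).asymm_s16 hi ((hPG i).2 hn).2.2,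
      fun hi => ((hPG i).1 hi).2.1⟩
  exact almostDecisivePair_of_witness hI hP (fun i =>
    ⟨fun hi => by_contra fun hn => (hD.2 P hP i).asymm_s16 hi ((hPG i).2 hn).1,
      fun hi => ((hPG i).1 hi).2.2⟩) ((hF P hP).2.1 x y z hxy hyz)

theorem AlmostDecisivePair.of_worsen_right {X : Type*} {n : ℕ} {D : Set (Profile n X)}
    {F : Profile n X → X → X → Prop} (hD : IsDomain D) (hF : IsSWF D F) (hU : Unanimity D F)
    (hI : IIA D F) {G : Set (Fin n)} {x y z : X} (hS : HasPolarizedSubprofile D G x y z y z x)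
    (h : AlmostDecisivePair D F G x y) : AlmostDecisivePair D F G x z := by
  obtain ⟨P, hP, hPG⟩ := hS
  have hyz : F P y z := hU P hP y z fun i => by
    by_cases hi : i ∈ G
    · exact ((hPG i).1 hi).2.1
    · exact ((hPG i).2 hi).1
  have hxy : F P x y := h P hP fun i =>
    ⟨fun hi => by_contra fun hn => (hD.2 P hP i).asymm_s16 hi ((hPG i).2 hn).2.2,
      fun hi => ((hPG i).1 hi).1⟩
  exact almostDecisivePair_of_witness hI hP (fun i =>
    ⟨fun hi => by_contra fun hn => (hD.2 P hP i).asymm_s16 hi ((hPG i).2 hn).2.1,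
      fun hi => ((hPG i).1 hi).2.2⟩) ((hF P hP).2.1 x y z hxy hyz)

/-- Polarization spreads almost decisiveness over one pair to the other pairs of a triple. -/
theorem AlmostDecisivePair.spread_triple {X : Type*} {n : ℕ} {D : Set (Profile n X)}
    {F : Profile n X → X → X → Prop} (hD : IsDomain D) (hPT : ClassPT D) (hF : IsSWF D F)
    (hU : Unanimity D F) (hI : IIA D F) {G : Set (Fin n)} (hG₀ : G ≠ ∅) (hG₁ : G ≠ univ)
    {a b c : X} (hab : a ≠ b) (hbc : b ≠ c) (hac : a ≠ c) (h : AlmostDecisivePair D F G a b) :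
    AlmostDecisivePair D F G a c ∧ AlmostDecisivePair D F G c b ∧
      AlmostDecisivePair D F G b a ∧ AlmostDecisivePair D F G b c := by
  rcases hPT G hG₀ hG₁ a b c hab hbc hac with ⟨h1, h2, h3, -, h5, h6⟩ | ⟨h1, h2, h3, h4, h5, h6⟩
  · have hcb := of_improve_left hD hF hU hI h5 h
    have hca := of_worsen_right hD hF hU hI h6 hcb
    have hba := of_improve_left hD hF hU hI h1 hca
    have hbc := of_worsen_right hD hF hU hI h2 hba
    exact ⟨of_improve_left hD hF hU hI h3 hbc, hcb, hba, hbc⟩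
  · have hac := of_worsen_right hD hF hU hI h1 h
    have hbc := of_improve_left hD hF hU hI h6 hac
    have hba := of_worsen_right hD hF hU hI h5 hbc
    have hca := of_improve_left hD hF hU hI h4 hba
    exact ⟨hac, of_worsen_right hD hF hU hI h3 hca, hba, hbc⟩

/-- Polarization spreads almost decisiveness over one pair to all pairs. -/
theorem AlmostDecisivePair.almostDecisive {X : Type*} [Fintype X] {n : ℕ}
    (hX : 3 ≤ Fintype.card X) {D : Set (Profile n X)}
    {F : Profile n X → X → X → Prop} (hD : IsDomain D) (hPT : ClassPT D) (hF : IsSWF D F)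
    (hU : Unanimity D F) (hI : IIA D F) {G : Set (Fin n)} (hG₀ : G ≠ ∅) (hG₁ : G ≠ univ)
    {a b : X} (hab : a ≠ b) (h : AlmostDecisivePair D F G a b) : AlmostDecisive D F G := by
  intro p q hpq
  by_cases hpa : p = a
  · subst hpa
    by_cases hqb : q = b
    · exact hqb ▸ h
    · exact (h.spread_triple hD hPT hF hU hI hG₀ hG₁ hab (Ne.symm hqb) hpq).1
  by_cases hpb : p = b
  · subst hpb
    by_cases hqa : q = a
    · subst hqa
      obtain ⟨c, hcp, hcq⟩ := exists_ne_ne_of_three_le_card hX p q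
      exact (h.spread_triple hD hPT hF hU hI hG₀ hG₁ hab hcp.symm hcq.symm).2.2.1
    · exact (h.spread_triple hD hPT hF hU hI hG₀ hG₁ hab hpq (Ne.symm hqa)).2.2.2
  have hp := (h.spread_triple hD hPT hF hU hI hG₀ hG₁ hab (Ne.symm hpb) (Ne.symm hpa)).2.1
  by_cases hqb : q = b
  · exact hqb ▸ hp
  · exact (hp.spread_triple hD hPT hF hU hI hG₀ hG₁ hpb (Ne.symm hqb) hpq).1

/-- Every coalition or its complement is nonempty and almost decisive. -/
theorem almostDecisive_or_compl {X : Type*} [Fintype X] {n : ℕ} [NeZero n]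
    (hX : 3 ≤ Fintype.card X) {D : Set (Profile n X)}
    {F : Profile n X → X → X → Prop} (hD : IsDomain D) (hPT : ClassPT D) (hF : IsSWF D F)
    (hU : Unanimity D F) (hI : IIA D F) (G : Set (Fin n)) :
    (G ≠ ∅ ∧ AlmostDecisive D F G) ∨ (Gᶜ ≠ ∅ ∧ AlmostDecisive D F Gᶜ) := by
  have huniv : (univ : Set (Fin n)) ≠ ∅ ∧ AlmostDecisive D F univ :=
    ⟨univ_nonempty.ne_empty, fun a b _ P hP hi => hU P hP a b fun i => (hi i).2 (mem_univ i)⟩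
  by_cases hG₀ : G = ∅
  · right; rwa [hG₀, compl_empty]
  by_cases hG₁ : G = univ
  · left; rwa [hG₁]
  have hGc₀ : Gᶜ ≠ ∅ := by rwa [Ne, compl_empty_iff]
  have hGc₁ : Gᶜ ≠ univ := by rwa [Ne, compl_univ_iff]
  obtain ⟨a, b, c, hab, hac, hbc⟩ := Fintype.two_lt_card_iff.1 hX
  have hex : ∃ P ∈ D, ∀ i, P i b a ↔ i ∈ G := by
    rcases hPT G hG₀ hG₁ a b c hab hbc hac with ⟨⟨P, hP, h⟩, -⟩ | ⟨-, -, -, -, ⟨P, hP, h⟩, -⟩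
    · exact ⟨P, hP, fun i => ⟨fun hi => by_contra fun hn =>
        (hD.2 P hP i).asymm_s16 hi ((h i).2 hn).1, fun hi => ((h i).1 hi).2.2⟩⟩
    · exact ⟨P, hP, fun i => ⟨fun hi => by_contra fun hn =>
        (hD.2 P hP i).asymm_s16 hi ((h i).2 hn).2.1, fun hi => ((h i).1 hi).2.2⟩⟩
  obtain ⟨P, hP, hPG⟩ := hex
  rcases (hF P hP).2.2 b a hab.symm with h | h
  · exact .inl ⟨hG₀, (almostDecisivePair_of_witness hI hP hPG h).almostDecisive
      hX hD hPT hF hU hI hG₀ hG₁ hab.symm⟩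
  · refine .inr ⟨hGc₀, (almostDecisivePair_of_witness hI hP (fun i => ?_) h).almostDecisive
      hX hD hPT hF hU hI hGc₀ hGc₁ hab⟩
    rw [mem_compl_iff, ← hPG i, (hD.2 P hP i).not_iff hab.symm]

/-- Diversity makes nonempty almost decisive coalitions closed under intersection. -/
theorem AlmostDecisive.inter {X : Type*} [Fintype X] {n : ℕ}
    (hX : 3 ≤ Fintype.card X) {D : Set (Profile n X)}
    {F : Profile n X → X → X → Prop} (hD : IsDomain D) (hPT : ClassPT D) (hDT : ClassDT D)
    (hF : IsSWF D F) (hU : Unanimity D F) (hI : IIA D F) {G H : Set (Fin n)}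
    (hG₀ : G ≠ ∅) (hG : AlmostDecisive D F G) (hH₀ : H ≠ ∅) (hH : AlmostDecisive D F H) :
    G ∩ H ≠ ∅ ∧ AlmostDecisive D F (G ∩ H) := by
  by_cases hGH : G ⊆ H
  · rw [inter_eq_left.2 hGH]; exact ⟨hG₀, hG⟩
  by_cases hHG : H ⊆ G
  · rw [inter_eq_right.2 hHG]; exact ⟨hH₀, hH⟩
  obtain ⟨a, b, c, hab, hbc, hac, P, hP, h⟩ := hDT G H hGH hHG
  have hFac : F P a c := (hF P hP).2.1 a b c (hG a b hab P hP fun i => (h i).1)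
    (hH b c hbc P hP fun i => (h i).2.1)
  have hne : G ∩ H ≠ ∅ := fun he => (hF P hP).asymm_s16 hFac
    (hU P hP c a fun i => (h i).2.2.2 (he ▸ notMem_empty i))
  have hnu : G ∩ H ≠ univ := fun hu => hGH fun i _ => (hu ▸ mem_univ i : i ∈ G ∩ H).2
  refine ⟨hne, (almostDecisivePair_of_witness hI hP (fun i => ?_) hFac).almostDecisive
    hX hD hPT hF hU hI hne hnu hac⟩
  rw [← (hD.2 P hP i).not_iff hac.symm, (h i).2.2, not_not]

theorem arrowInconsistent_of_classPT_of_classDT {X : Type*} [Fintype X] {n : ℕ} [NeZero n]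
    (hX : 3 ≤ Fintype.card X) {D : Set (Profile n X)} (hD : IsDomain D)
    (hPT : ClassPT D) (hDT : ClassDT D) : ArrowInconsistent D := by
  intro F hF hU hI
  have hor := almostDecisive_or_compl hX hD hPT hF hU hI
  obtain ⟨M, ⟨hM₀, hM⟩, hmin⟩ :=
    (toFinite {G : Set (Fin n) | G ≠ ∅ ∧ AlmostDecisive D F G}).exists_minimal
      ((hor univ).elim (fun h => ⟨_, h⟩) fun h => ⟨_, h⟩)
  obtain ⟨d, hd⟩ := nonempty_iff_ne_empty.2 hM₀
  refine ⟨d, fun P hP a b hPab => ?_⟩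
  have hab : a ≠ b := fun h => (hD.2 P hP d).1 a (h ▸ hPab)
  rcases hor {i | P i a b} with h | h
  · exact h.2 a b hab P hP fun i => Iff.rfl
  · have hle := hmin (hM.inter hX hD hPT hDT hF hU hI hM₀ h.1 h.2) inter_subset_left
    exact ((hle hd).2 hPab).elim

/-- every domain in 𝒟^PT ∩ 𝒟^DT is super-Arrovian. -/
theorem super_arrovian {X : Type*} [Fintype X] {n : ℕ}
    (hX : 3 ≤ Fintype.card X) (hn : 2 ≤ n)
    (D : Set (Profile n X)) (hD : IsDomain D)
    (hPT : ClassPT D) (hDT : ClassDT D) :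
    ArrowInconsistent D ∧
      ∀ D' : Set (Profile n X), IsDomain D' → D ⊆ D' → ArrowInconsistent D' := by
  have : NeZero n := ⟨by omega⟩
  have hext : ∀ D' : Set (Profile n X), IsDomain D' → D ⊆ D' → ArrowInconsistent D' := by
    intro D' hD' hsub
    have hmono : ∀ {G : Set (Fin n)} {a b c a' b' c' : X},
        HasPolarizedSubprofile D G a b c a' b' c' → HasPolarizedSubprofile D' G a b c a' b' c' :=
      fun ⟨P, hP, h⟩ => ⟨P, hsub hP, h⟩
    refine arrowInconsistent_of_classPT_of_classDT hX hD' (fun G hG₀ hG₁ a b c hab hbc hac => ?_)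
      fun G H hGH hHG => ?_
    · exact (hPT G hG₀ hG₁ a b c hab hbc hac).imp
        (fun ⟨h1, h2, h3, h4, h5, h6⟩ =>
          ⟨hmono h1, hmono h2, hmono h3, hmono h4, hmono h5, hmono h6⟩)
        (fun ⟨h1, h2, h3, h4, h5, h6⟩ =>
          ⟨hmono h1, hmono h2, hmono h3, hmono h4, hmono h5, hmono h6⟩)
    · obtain ⟨a, b, c, hab, hbc, hac, P, hP, h⟩ := hDT G H hGH hHG
      exact ⟨a, b, c, hab, hbc, hac, P, hsub hP, h⟩
  exact ⟨hext D hD Subset.rfl, hext⟩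

end ArrowSC
end
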